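/- Let g ≥ 1, let τ be an element of the Siegel upper half-space H_g, let z ∈ ℂ^g, let ε, β ∈ ℤ^g, and let δ ∈ {0,1}^g ⊂ ℤ^g. Then Σ_{α ∈ {0,1}^g} (−1)^{α·δ} θ[α,β](2τ,2z)·θ[α+ε,β](2τ,0) = θ[ε,β+δ](τ,z)·θ[ε,δ](τ,z), where the sum ranges over the 2^g vectors α ∈ {0,1}^g ⊂ ℤ^g and sums of characteristics such as α+ε and β+δ are literal sums of integer vectors. -/

import Mathlib

open scoped BigOperators
open Complex

noncomputable section

/-- The Siegel upper half-space condition: a complex symmetric `g × g` matrix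
whose imaginary part is positive definite. -/
def IsSiegel {g : ℕ} (τ : Matrix (Fin g) (Fin g) ℂ) : Prop :=
  τ.IsSymm ∧ Matrix.PosDef (Matrix.of fun i j => (τ i j).im)

/-- The theta function with characteristic `[ε, δ]`:
`θ[ε,δ](τ,z) = Σ_{m ∈ ℤ^g} exp(πi((m+ε/2)ᵀτ(m+ε/2) + 2(m+ε/2)·(z+δ/2)))`. -/
def theta {g : ℕ} (τ : Matrix (Fin g) (Fin g) ℂ) (ε δ : Fin g → ℤ)
    (z : Fin g → ℂ) : ℂ :=
  ∑' m : Fin g → ℤ,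
    Complex.exp (↑Real.pi * Complex.I *
      ((∑ i, ∑ j, ((m i : ℂ) + (ε i : ℂ) / 2) * τ i j * ((m j : ℂ) + (ε j : ℂ) / 2)) +
        2 * ∑ i, ((m i : ℂ) + (ε i : ℂ) / 2) * (z i + (δ i : ℂ) / 2)))

/-- The summand of `theta`. -/
def thetaTerm {g : ℕ} (τ : Matrix (Fin g) (Fin g) ℂ) (ε δ : Fin g → ℤ)
    (z : Fin g → ℂ) (m : Fin g → ℤ) : ℂ :=
  Complex.exp (↑Real.pi * Complex.I *
      ((∑ i, ∑ j, ((m i : ℂ) + (ε i : ℂ) / 2) * τ i j * ((m j : ℂ) + (ε j : ℂ) / 2)) +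
        2 * ∑ i, ((m i : ℂ) + (ε i : ℂ) / 2) * (z i + (δ i : ℂ) / 2)))

/-- A positive definite real quadratic form dominates a positive multiple of the sum of squares. -/
lemma Matrix.PosDef.exists_pos_mul_sum_sq_le {ι : Type*} [Fintype ι] {Y : Matrix ι ι ℝ}
    (hY : Y.PosDef) :
    ∃ c > 0, ∀ u : ι → ℝ, c * ∑ i, u i ^ 2 ≤ ∑ i, ∑ j, u i * Y i j * u j := by
  have hpos : ∀ u : ι → ℝ, u ≠ 0 → 0 < ∑ i, ∑ j, u i * Y i j * u j := by
    intro u hu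
    have h := hY.dotProduct_mulVec_pos hu
    simpa [dotProduct, Matrix.mulVec, Finset.mul_sum, mul_assoc] using h
  have hsq : ∀ u : ι → ℝ, u ≠ 0 → 0 < ∑ i, u i ^ 2 := by
    intro u hu
    obtain ⟨i, hi⟩ := Function.ne_iff.mp hu
    exact Finset.sum_pos' (fun _ _ => sq_nonneg _) ⟨i, Finset.mem_univ i, sq_pos_of_ne_zero hi⟩
  have hne : ∀ u ∈ Metric.sphere (0 : ι → ℝ) 1, u ≠ 0 := fun u hu h => by simp [h] at hu
  have hcont : ContinuousOn (fun u : ι → ℝ => (∑ i, ∑ j, u i * Y i j * u j) / ∑ i, u i ^ 2)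
      (Metric.sphere 0 1) :=
    ContinuousOn.div (by fun_prop) (by fun_prop) fun u hu => (hsq u (hne u hu)).ne'
  obtain ⟨c, hc, hle⟩ := (isCompact_sphere (0 : ι → ℝ) 1).exists_forall_le' (a := 0) hcont
    fun u hu => div_pos (hpos u (hne u hu)) (hsq u (hne u hu))
  refine ⟨c, hc, fun u => ?_⟩
  rcases eq_or_ne u 0 with rfl | hu
  · simp
  have hn : 0 < ‖u‖ := norm_pos_iff.mpr hu
  have h := hle (‖u‖⁻¹ • u) (by simp [norm_smul, hn.ne'])
  have h₁ : ∑ i, (‖u‖⁻¹ • u) i ^ 2 = (‖u‖⁻¹) ^ 2 * ∑ i, u i ^ 2 := by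
    simp [mul_pow, Finset.mul_sum]
  have h₂ : ∑ i, ∑ j, (‖u‖⁻¹ • u) i * Y i j * (‖u‖⁻¹ • u) j =
      (‖u‖⁻¹) ^ 2 * ∑ i, ∑ j, u i * Y i j * u j := by
    simp only [Finset.mul_sum, Pi.smul_apply, smul_eq_mul]
    exact Finset.sum_congr rfl fun i _ => Finset.sum_congr rfl fun j _ => by ring
  rw [h₁, h₂, mul_div_mul_left _ _ (by positivity), le_div_iff₀ (hsq u hu)] at h
  exact h

/-- A product of nonnegative summable functions of separate variables is summable. -/
lemma summable_fin_prod_of_nonneg {α : Type*} {g : ℕ} {f : Fin g → α → ℝ}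
    (hf : ∀ i, Summable (f i)) (h0 : ∀ i a, 0 ≤ f i a) :
    Summable fun m : Fin g → α => ∏ i, f i (m i) := by
  induction g with
  | zero => exact Summable.of_finite
  | succ n ih =>
    rw [← (Fin.consEquiv fun _ => α).summable_iff]
    have h := (hf 0).mul_of_nonneg (ih (f := fun i => f i.succ) (fun i => hf _) fun i => h0 _)
      (h0 0) fun m => Finset.prod_nonneg fun i _ => h0 _ _
    refine h.congr fun x => ?_
    simp [Fin.prod_univ_succ, Fin.consEquiv]

/-- One-dimensional Gaussian sums over a shifted lattice converge. -/
lemma summable_exp_neg_mul_sq_add {c : ℝ} (hc : 0 < c) (a y : ℝ) :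
    Summable fun n : ℤ => Real.exp (-Real.pi * (c * (n + a) ^ 2 + 2 * ((n + a) * y))) := by
  have h := ((summable_jacobiTheta₂_term_iff ((c * a + y : ℝ) * I) ((c : ℝ) * I)).mpr
    (by simpa using hc)).norm.mul_left (Real.exp (-Real.pi * (c * a ^ 2 + 2 * (a * y))))
  refine h.congr fun n => ?_
  rw [norm_jacobiTheta₂_term, ← Real.exp_add]
  congr 1
  simp
  ring

lemma norm_thetaTerm {g : ℕ} (τ : Matrix (Fin g) (Fin g) ℂ) (ε δ : Fin g → ℤ)
    (z : Fin g → ℂ) (m : Fin g → ℤ) :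
    ‖thetaTerm τ ε δ z m‖ = Real.exp (-Real.pi *
      ((∑ i, ∑ j, ((m i : ℝ) + (ε i : ℝ) / 2) * (τ i j).im * ((m j : ℝ) + (ε j : ℝ) / 2)) +
        2 * ∑ i, ((m i : ℝ) + (ε i : ℝ) / 2) * (z i).im)) := by
  have hu : ∀ i, (m i : ℂ) + (ε i : ℂ) / 2 = (((m i : ℝ) + (ε i : ℝ) / 2 : ℝ) : ℂ) := by
    intro i; push_cast; rfl
  have hd : ∀ i, (z i + (δ i : ℂ) / 2).im = (z i).im := by
    intro i
    have : (δ i : ℂ) / 2 = (((δ i : ℝ) / 2 : ℝ) : ℂ) := by push_cast; rfl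
    rw [this, add_im, ofReal_im, add_zero]
  rw [thetaTerm, Complex.norm_exp]
  congr 1
  simp only [hu]
  rw [mul_assoc, re_ofReal_mul, I_mul_re, add_im]
  nth_rw 1 [show (2 : ℂ) = ((2 : ℝ) : ℂ) by simp]
  simp only [im_sum, im_mul_ofReal, im_ofReal_mul, hd]
  ring

lemma IsSiegel.summable_norm_thetaTerm {g : ℕ} {τ : Matrix (Fin g) (Fin g) ℂ} (hτ : IsSiegel τ)
    (ε δ : Fin g → ℤ) (z : Fin g → ℂ) : Summable fun m => ‖thetaTerm τ ε δ z m‖ := by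
  obtain ⟨c, hc, hle⟩ := hτ.2.exists_pos_mul_sum_sq_le
  refine Summable.of_nonneg_of_le (fun _ => norm_nonneg _) (fun m => ?_)
    (summable_fin_prod_of_nonneg
      (fun i => summable_exp_neg_mul_sq_add hc ((ε i : ℝ) / 2) (z i).im)
      fun _ _ => (Real.exp_pos _).le)
  rw [norm_thetaTerm, ← Real.exp_sum, ← Finset.mul_sum, Finset.sum_add_distrib,
    ← Finset.mul_sum, ← Finset.mul_sum]
  have h := hle fun i => (m i : ℝ) + (ε i : ℝ) / 2
  simp only [Matrix.of_apply] at h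
  refine Real.exp_le_exp.mpr ?_
  nlinarith [Real.pi_pos]

lemma IsSiegel.two_smul {g : ℕ} {τ : Matrix (Fin g) (Fin g) ℂ} (hτ : IsSiegel τ) :
    IsSiegel ((2 : ℂ) • τ) := by
  refine ⟨hτ.1.smul 2, ?_⟩
  have h := hτ.2.smul (show (0 : ℝ) < 2 by norm_num)
  convert h using 1
  ext i j
  simp

/-- The pairs `(P + Q + α, P - Q - ε)`, with `α ∈ {0,1}^g`, run exactly once through all pairs of
integer vectors. -/
def latticePairEquiv {g : ℕ} (ε : Fin g → ℤ) :
    ((Fin g → Fin 2) × (Fin g → ℤ) × (Fin g → ℤ)) ≃ (Fin g → ℤ) × (Fin g → ℤ) :=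
  Equiv.ofBijective
    (fun x => (fun k => x.2.1 k + x.2.2 k + ((x.1 k : ℕ) : ℤ), fun k => x.2.1 k - x.2.2 k - ε k))
    (by
      constructor
      · rintro ⟨α, P, Q⟩ ⟨α₂, P₂, Q₂⟩ h
        simp only [Prod.mk.injEq, funext_iff] at h ⊢
        refine ⟨fun k => Fin.ext ?_, fun k => ?_, fun k => ?_⟩ <;>
        · have h₁ := h.1 k
          have h₂ := h.2 k
          have := (α k).isLt
          have := (α₂ k).isLt
          omega
      · rintro ⟨m, n⟩
        refine ⟨(fun k => ⟨((m k + n k + ε k) % 2).toNat, by omega⟩,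
          fun k => (m k + n k + ε k) / 2, fun k => (m k - n k - ε k - (m k + n k + ε k) % 2) / 2),
          ?_⟩
        simp only [Prod.mk.injEq, funext_iff]
        refine ⟨fun k => ?_, fun k => ?_⟩ <;> omega)

lemma thetaTerm_mul_thetaTerm {g : ℕ} (τ : Matrix (Fin g) (Fin g) ℂ) (z : Fin g → ℂ)
    (ε β δ α P Q : Fin g → ℤ) :
    thetaTerm τ ε (β + δ) z (fun k => P k + Q k + α k) *
        thetaTerm τ ε δ z (fun k => P k - Q k - ε k) =
      (-1 : ℂ) ^ (∑ k, α k * δ k) *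
        (thetaTerm ((2 : ℂ) • τ) α β (fun k => 2 * z k) P *
          thetaTerm ((2 : ℂ) • τ) (α + ε) β 0 Q) := by
  have hsign : (-1 : ℂ) ^ (∑ k, α k * δ k) =
      Complex.exp (Real.pi * I * ∑ k, (α k : ℂ) * (δ k : ℂ)) := by
    rw [← Complex.exp_pi_mul_I, ← Complex.exp_int_mul]
    push_cast
    ring_nf
  rw [hsign]
  simp only [thetaTerm]
  rw [← Complex.exp_add, ← Complex.exp_add, ← Complex.exp_add, Complex.exp_eq_exp_iff_exists_int]
  refine ⟨∑ k, P k * δ k, ?_⟩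
  rw [show ((∑ k, P k * δ k : ℤ) : ℂ) * (2 * Real.pi * I) =
    Real.pi * I * (2 * ∑ k, (P k : ℂ) * (δ k : ℂ)) by push_cast; ring]
  have hquad :
      (∑ i, ∑ j, (((P i + Q i + α i : ℤ) : ℂ) + (ε i : ℂ) / 2) * τ i j *
          (((P j + Q j + α j : ℤ) : ℂ) + (ε j : ℂ) / 2)) +
        ∑ i, ∑ j, (((P i - Q i - ε i : ℤ) : ℂ) + (ε i : ℂ) / 2) * τ i j *
          (((P j - Q j - ε j : ℤ) : ℂ) + (ε j : ℂ) / 2) =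
      (∑ i, ∑ j, ((P i : ℂ) + (α i : ℂ) / 2) * ((2 : ℂ) • τ) i j * ((P j : ℂ) + (α j : ℂ) / 2)) +
        ∑ i, ∑ j, ((Q i : ℂ) + ((α + ε) i : ℂ) / 2) * ((2 : ℂ) • τ) i j *
          ((Q j : ℂ) + ((α + ε) j : ℂ) / 2) := by
    simp only [← Finset.sum_add_distrib, Matrix.smul_apply, smul_eq_mul, Pi.add_apply]
    refine Finset.sum_congr rfl fun i _ => Finset.sum_congr rfl fun j _ => ?_
    push_cast
    ring
  have hlin :
      2 * (∑ i, (((P i + Q i + α i : ℤ) : ℂ) + (ε i : ℂ) / 2) * (z i + ((β + δ) i : ℂ) / 2)) +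
        2 * ∑ i, (((P i - Q i - ε i : ℤ) : ℂ) + (ε i : ℂ) / 2) * (z i + (δ i : ℂ) / 2) =
      (∑ i, (α i : ℂ) * (δ i : ℂ)) +
        2 * (∑ i, ((P i : ℂ) + (α i : ℂ) / 2) * (2 * z i + (β i : ℂ) / 2)) +
        2 * (∑ i, ((Q i : ℂ) + ((α + ε) i : ℂ) / 2) * ((0 : Fin g → ℂ) i + (β i : ℂ) / 2)) +
        2 * ∑ i, (P i : ℂ) * (δ i : ℂ) := by
    simp only [Finset.mul_sum, ← Finset.sum_add_distrib, Pi.add_apply, Pi.zero_apply]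
    refine Finset.sum_congr rfl fun i _ => ?_
    push_cast
    ring
  linear_combination Real.pi * I * (hquad + hlin)

theorem statement5 {g : ℕ} (hg : 1 ≤ g) (τ : Matrix (Fin g) (Fin g) ℂ)
    (hτ : IsSiegel τ) (z : Fin g → ℂ) (ε β : Fin g → ℤ) (δ : Fin g → ℤ)
    (hδ : ∀ k, δ k = 0 ∨ δ k = 1) :
    ∑ α : Fin g → Fin 2,
        (-1 : ℂ) ^ (∑ k, ((α k : ℕ) : ℤ) * δ k) *
          (theta ((2 : ℂ) • τ) (fun k => ((α k : ℕ) : ℤ)) β (fun k => 2 * z k) *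
            theta ((2 : ℂ) • τ) ((fun k => ((α k : ℕ) : ℤ)) + ε) β 0) =
      theta τ ε (β + δ) z * theta τ ε δ z := by
  have hF : Summable fun x => thetaTerm τ ε (β + δ) z (latticePairEquiv ε x).1 *
      thetaTerm τ ε δ z (latticePairEquiv ε x).2 :=
    (latticePairEquiv ε).summable_iff.mpr (summable_mul_of_summable_norm
      (hτ.summable_norm_thetaTerm ε (β + δ) z) (hτ.summable_norm_thetaTerm ε δ z))
  change _ = (∑' m, thetaTerm τ ε (β + δ) z m) * ∑' n, thetaTerm τ ε δ z n
  rw [tsum_mul_tsum_of_summable_norm (hτ.summable_norm_thetaTerm _ _ _)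
      (hτ.summable_norm_thetaTerm _ _ _), ← (latticePairEquiv ε).tsum_eq,
    hF.tsum_prod, tsum_fintype]
  refine Finset.sum_congr rfl fun α _ => ?_
  change _ * ((∑' P, thetaTerm _ _ _ _ P) * ∑' Q, thetaTerm _ _ _ _ Q) = _
  rw [tsum_mul_tsum_of_summable_norm (hτ.two_smul.summable_norm_thetaTerm _ _ _)
      (hτ.two_smul.summable_norm_thetaTerm _ _ _), ← tsum_mul_left]
  exact tsum_congr fun x => (thetaTerm_mul_thetaTerm τ z ε β δ (fun k => ((α k : ℕ) : ℤ))
    x.1 x.2).symm
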